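/- Let K = u/v be shift-reduced with K ≠ 1, and let r and s be residual forms with respect to K. Then there exists a residual form t with respect to K such that s − t ∈ V_K and, for all λ, μ ∈ F, the rational function λ·r + μ·t is a residual form with respect to K; consequently (λ·r + μ·s) − (λ·r + μ·t) ∈ V_K for all λ, μ ∈ F. -/

import Mathlib

open Polynomial

noncomputable def pshift (F : Type*) [Field F] (i : ℤ) :
    Polynomial F →ₐ[F] Polynomial F :=
  aeval (X + C (i : F))

noncomputable def rshift (F : Type*) [Field F] (i : ℤ) : RatFunc F → RatFunc F :=
  fun f => RatFunc.mk (pshift F i f.num) (pshift F i f.denom)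

def shiftFree {F : Type*} [Field F] (p : Polynomial F) : Prop :=
  p ≠ 0 ∧ ∀ i : ℤ, i ≠ 0 → IsCoprime p (pshift F i p)

def shiftReducedPair {F : Type*} [Field F] (u v : Polynomial F) : Prop :=
  u ≠ 0 ∧ v ≠ 0 ∧ IsCoprime u v ∧ ∀ i : ℤ, IsCoprime u (pshift F i v)

def stronglyPrime {F : Type*} [Field F] (p u v : Polynomial F) : Prop :=
  p ≠ 0 ∧ ∀ i : ℕ, IsCoprime p (pshift F (-(i : ℤ)) u) ∧ IsCoprime p (pshift F (i : ℤ) v)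

noncomputable def phiK {F : Type*} [Field F] (u v : Polynomial F) :
    Polynomial F → Polynomial F :=
  fun p => u * pshift F 1 p - v * p

noncomputable def WK (F : Type*) [Field F] (u v : Polynomial F) :
    Submodule F (Polynomial F) :=
  Submodule.span F {q : Polynomial F | ∃ ℓ : ℕ, q = X ^ ℓ ∧
    ∀ w : Polynomial F, w ∈ Set.range (phiK u v) → w ≠ 0 → ℓ ≠ w.natDegree}

def VK {F : Type*} [Field F] (K : RatFunc F) : Set (RatFunc F) :=
  {g | ∃ r : RatFunc F, g = K * rshift F 1 r - r}

def residualForm {F : Type*} [Field F] (u v : Polynomial F) (r : RatFunc F) : Prop :=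
  ∃ a b q : Polynomial F, a.degree < b.degree ∧ shiftFree b ∧ stronglyPrime b u v ∧
    q ∈ WK F u v ∧ r = RatFunc.mk a b + RatFunc.mk q v

section Shift

variable {F : Type*} [Field F]

theorem pshift_zero (p : F[X]) : pshift F 0 p = p := by
  simp [pshift]

theorem pshift_pshift (i j : ℤ) (p : F[X]) :
    pshift F i (pshift F j p) = pshift F (i + j) p := by
  have h : (pshift F i).comp (pshift F j) = pshift F (i + j) := by
    ext
    simp [pshift]
    ring
  exact DFunLike.congr_fun h p

theorem pshift_injective (i : ℤ) : Function.Injective (pshift F i) := by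
  intro p q h
  have h' := congrArg (pshift F (-i)) h
  simpa [pshift_pshift, pshift_zero] using h'

theorem pshift_ne_zero (i : ℤ) {p : F[X]} (hp : p ≠ 0) : pshift F i p ≠ 0 :=
  (map_ne_zero_iff _ (pshift_injective i)).2 hp

theorem isCoprime_pshift {p q : F[X]} (h : IsCoprime p q) (i : ℤ) :
    IsCoprime (pshift F i p) (pshift F i q) :=
  h.map (pshift F i).toRingHom

theorem IsCoprime.pshift_left_of_right {p q : F[X]} {i : ℤ} (h : IsCoprime p (pshift F i q)) :
    IsCoprime (pshift F (-i) p) q := by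
  simpa [pshift_pshift, pshift_zero] using isCoprime_pshift h (-i)

theorem shiftFree.of_dvd_pow {p q : F[X]} {n : ℕ} (hq : shiftFree q) (hp : p ≠ 0)
    (h : p ∣ q ^ n) : shiftFree p := by
  refine ⟨hp, fun i hi => ?_⟩
  have h₁ : IsCoprime (q ^ n) (pshift F i q ^ n) := IsCoprime.pow (hq.2 i hi)
  have h₂ : pshift F i p ∣ pshift F i q ^ n := by
    have h₃ := map_dvd (pshift F i) h
    rwa [map_pow] at h₃
  exact (h₁.of_isCoprime_of_dvd_left h).of_isCoprime_of_dvd_right h₂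

theorem shiftFree.mul {p q : F[X]} (hp : shiftFree p) (hq : shiftFree q)
    (h : ∀ i : ℤ, i ≠ 0 → IsCoprime q (pshift F i p)) : shiftFree (p * q) := by
  refine ⟨mul_ne_zero hp.1 hq.1, fun i hi => ?_⟩
  have h' : IsCoprime p (pshift F i q) := by
    have := (h (-i) (neg_ne_zero.2 hi)).pshift_left_of_right
    rw [neg_neg] at this
    exact this.symm
  rw [map_mul]
  exact ((hp.2 i hi).mul_right h').mul_left ((h i hi).mul_right (hq.2 i hi))

theorem stronglyPrime.of_dvd_pow {p q u v : F[X]} {n : ℕ} (hq : stronglyPrime q u v)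
    (hp : p ≠ 0) (h : p ∣ q ^ n) : stronglyPrime p u v :=
  ⟨hp, fun i => ⟨((hq.2 i).1.pow_left).of_isCoprime_of_dvd_left h,
    ((hq.2 i).2.pow_left).of_isCoprime_of_dvd_left h⟩⟩

theorem stronglyPrime.mul {p q u v : F[X]} (hp : stronglyPrime p u v)
    (hq : stronglyPrime q u v) : stronglyPrime (p * q) u v :=
  ⟨mul_ne_zero hp.1 hq.1, fun i => ⟨(hp.2 i).1.mul_left (hq.2 i).1,
    (hp.2 i).2.mul_left (hq.2 i).2⟩⟩

/-- The shift as a ring endomorphism of the field of rational functions. -/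
noncomputable def ratShift (F : Type*) [Field F] (i : ℤ) : RatFunc F →+* RatFunc F :=
  RatFunc.mapRingHom (pshift F i)
    (nonZeroDivisors_le_comap_nonZeroDivisors_of_injective _ (pshift_injective i))

theorem rshift_eq_ratShift (i : ℤ) (f : RatFunc F) : rshift F i f = ratShift F i f := by
  rw [rshift, RatFunc.mk_eq_div]
  exact (RatFunc.map_apply (pshift F i)
    (nonZeroDivisors_le_comap_nonZeroDivisors_of_injective _ (pshift_injective i)) f).symm

theorem ratShift_algebraMap (i : ℤ) (p : F[X]) :
    ratShift F i (algebraMap F[X] (RatFunc F) p) = algebraMap _ _ (pshift F i p) := by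
  have h := RatFunc.map_apply_div (pshift F i)
    (nonZeroDivisors_le_comap_nonZeroDivisors_of_injective _ (pshift_injective i)) p 1
  simp only [map_one, div_one] at h
  exact h

theorem ratShift_smul (i : ℤ) (c : F) (f : RatFunc F) :
    ratShift F i (c • f) = c • ratShift F i f := by
  have h : algebraMap F (RatFunc F) c = algebraMap F[X] (RatFunc F) (C c) := rfl
  rw [Algebra.smul_def, Algebra.smul_def, map_mul, h, ratShift_algebraMap]
  simp [pshift]

end Shift

section Reduction

variable {F : Type*} [Field F]

theorem VK_add {K f g : RatFunc F} (hf : f ∈ VK K) (hg : g ∈ VK K) : f + g ∈ VK K := by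
  obtain ⟨r, rfl⟩ := hf
  obtain ⟨s, rfl⟩ := hg
  refine ⟨r + s, ?_⟩
  simp only [rshift_eq_ratShift, map_add]
  ring

theorem VK_smul {K f : RatFunc F} (c : F) (hf : f ∈ VK K) : c • f ∈ VK K := by
  obtain ⟨r, rfl⟩ := hf
  refine ⟨c • r, ?_⟩
  simp only [rshift_eq_ratShift, ratShift_smul]
  rw [smul_sub, mul_smul_comm]

theorem VK_zero (K : RatFunc F) : 0 ∈ VK K :=
  ⟨0, by simp [rshift_eq_ratShift]⟩

local notation "ι" => algebraMap (Polynomial F) (RatFunc F)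

theorem ratFunc_algebraMap_ne_zero {p : F[X]} (hp : p ≠ 0) : ι p ≠ 0 :=
  RatFunc.algebraMap_ne_zero hp

/-- Every fraction with denominator `d` is congruent modulo `V_K`, `K = u / v`, to the sum of a
fraction with denominator `e` and one with denominator `v`. -/
def denomReduces (u v d e : F[X]) : Prop :=
  ∀ a : F[X], ∃ a' q : F[X], ι a / ι d - (ι a' / ι e + ι q / ι v) ∈ VK (ι u / ι v)

theorem denomReduces.refl (u v d : F[X]) : denomReduces u v d d := fun a =>
  ⟨a, 0, by simpa using VK_zero _⟩

theorem denomReduces.trans {u v d e f : F[X]} (h₁ : denomReduces u v d e)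
    (h₂ : denomReduces u v e f) : denomReduces u v d f := by
  intro a
  obtain ⟨a₁, q₁, h₁⟩ := h₁ a
  obtain ⟨a₂, q₂, h₂⟩ := h₂ a₁
  refine ⟨a₂, q₁ + q₂, ?_⟩
  convert VK_add h₁ h₂ using 1
  rw [map_add]
  ring

theorem denomReduces.mul {u v d₁ d₂ e₁ e₂ : F[X]} (hd₁ : d₁ ≠ 0) (hd₂ : d₂ ≠ 0) (he₁ : e₁ ≠ 0)
    (he₂ : e₂ ≠ 0) (hd : IsCoprime d₁ d₂) (h₁ : denomReduces u v d₁ e₁)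
    (h₂ : denomReduces u v d₂ e₂) : denomReduces u v (d₁ * d₂) (e₁ * e₂) := by
  intro a
  obtain ⟨α, β, hαβ⟩ := hd
  obtain ⟨a₁, q₁, h₁⟩ := h₁ (a * β)
  obtain ⟨a₂, q₂, h₂⟩ := h₂ (a * α)
  refine ⟨a₁ * e₂ + a₂ * e₁, q₁ + q₂, ?_⟩
  convert VK_add h₁ h₂ using 1
  have hαβ' : ι α * ι d₁ + ι β * ι d₂ = 1 := by
    rw [← map_mul, ← map_mul, ← map_add, hαβ, map_one]
  have hd₁' := ratFunc_algebraMap_ne_zero hd₁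
  have hd₂' := ratFunc_algebraMap_ne_zero hd₂
  have he₁' := ratFunc_algebraMap_ne_zero he₁
  have he₂' := ratFunc_algebraMap_ne_zero he₂
  have e1 : ι a / ι (d₁ * d₂) = ι (a * β) / ι d₁ + ι (a * α) / ι d₂ := by
    simp only [map_mul]
    field_simp
    linear_combination (-ι a) * hαβ'
  have e2 : ι (a₁ * e₂ + a₂ * e₁) / ι (e₁ * e₂) = ι a₁ / ι e₁ + ι a₂ / ι e₂ := by
    simp only [map_mul, map_add]
    field_simp
  rw [e1, e2, map_add]
  ring

theorem denomReduces_pshift_one {u v d : F[X]} (hv : v ≠ 0) (hd : d ≠ 0)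
    (h : IsCoprime (pshift F 1 d) v) : denomReduces u v d (pshift F 1 d) := by
  intro a
  obtain ⟨α, β, hαβ⟩ := h
  refine ⟨u * pshift F 1 a * β, u * pshift F 1 a * α, -(ι a / ι d), ?_⟩
  have hαβ' : ι α * ι (pshift F 1 d) + ι β * ι v = 1 := by
    rw [← map_mul, ← map_mul, ← map_add, hαβ, map_one]
  have hv' := ratFunc_algebraMap_ne_zero hv
  have hd' := ratFunc_algebraMap_ne_zero (pshift_ne_zero 1 hd)
  have e : ι (u * pshift F 1 a * β) / ι (pshift F 1 d) + ι (u * pshift F 1 a * α) / ι v =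
      ι u / ι v * (ι (pshift F 1 a) / ι (pshift F 1 d)) := by
    simp only [map_mul]
    field_simp
    linear_combination (ι u * ι (pshift F 1 a)) * hαβ'
  rw [e, rshift_eq_ratShift, map_neg, map_div₀, ratShift_algebraMap, ratShift_algebraMap]
  ring

theorem denomReduces_of_pshift_one {u v d : F[X]} (hv : v ≠ 0) (hd : d ≠ 0)
    (h : IsCoprime (pshift F 1 d) u) : denomReduces u v (pshift F 1 d) d := by
  intro a
  obtain ⟨α, β, hαβ⟩ := h
  refine ⟨pshift F (-1) (a * β * v), a * α * v, ι (pshift F (-1) (a * β * v)) / ι d, ?_⟩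
  have hαβ' : ι α * ι (pshift F 1 d) + ι β * ι u = 1 := by
    rw [← map_mul, ← map_mul, ← map_add, hαβ, map_one]
  have hv' := ratFunc_algebraMap_ne_zero hv
  have hd' := ratFunc_algebraMap_ne_zero (pshift_ne_zero 1 hd)
  have e : ι a / ι (pshift F 1 d) - ι (a * α * v) / ι v =
      ι u / ι v * (ι (a * β * v) / ι (pshift F 1 d)) := by
    simp only [map_mul]
    field_simp
    linear_combination (-ι a) * hαβ'
  rw [rshift_eq_ratShift, map_div₀, ratShift_algebraMap, ratShift_algebraMap, pshift_pshift,
    add_neg_cancel, pshift_zero, ← e]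
  ring

theorem denomReduces_pshift {u v d : F[X]} (hv : v ≠ 0) (hd : d ≠ 0) (n : ℕ)
    (h : ∀ j : ℕ, j < n → IsCoprime (pshift F (j + 1) d) v) :
    denomReduces u v d (pshift F n d) := by
  induction n with
  | zero => simpa [pshift_zero] using denomReduces.refl u v d
  | succ n ih =>
    refine (ih fun j hj => h j (by omega)).trans ?_
    have e : pshift F ((n + 1 : ℕ) : ℤ) d = pshift F 1 (pshift F n d) := by
      rw [pshift_pshift, Nat.cast_succ, add_comm]
    rw [e]
    refine denomReduces_pshift_one hv (pshift_ne_zero _ hd) ?_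
    rw [← e, Nat.cast_succ]
    exact h n (by omega)

theorem denomReduces_of_pshift {u v d : F[X]} (hv : v ≠ 0) (hd : d ≠ 0) (n : ℕ)
    (h : ∀ j : ℕ, j < n → IsCoprime (pshift F (j + 1) d) u) :
    denomReduces u v (pshift F n d) d := by
  induction n with
  | zero => simpa [pshift_zero] using denomReduces.refl u v d
  | succ n ih =>
    refine denomReduces.trans ?_ (ih fun j hj => h j (by omega))
    have e : pshift F ((n + 1 : ℕ) : ℤ) d = pshift F 1 (pshift F n d) := by
      rw [pshift_pshift, Nat.cast_succ, add_comm]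
    rw [e]
    refine denomReduces_of_pshift_one hv (pshift_ne_zero _ hd) ?_
    rw [← e, Nat.cast_succ]
    exact h n (by omega)

theorem denomReduces_of_stronglyPrime {u v d : F[X]} (hv : v ≠ 0) (i : ℤ)
    (hd : stronglyPrime d u v) (hd' : stronglyPrime (pshift F i d) u v) :
    denomReduces u v d (pshift F i d) := by
  obtain ⟨n, rfl | rfl⟩ := i.eq_nat_or_neg
  · refine denomReduces_pshift hv hd.1 n fun j hj => ?_
    have h := (hd'.2 (n - (j + 1))).2.pshift_left_of_right
    rw [pshift_pshift] at h
    convert h using 3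
    omega
  · have e : d = pshift F n (pshift F (-n) d) := by
      rw [pshift_pshift, add_neg_cancel, pshift_zero]
    have key : denomReduces u v (pshift F n (pshift F (-n) d)) (pshift F (-n) d) := by
      refine denomReduces_of_pshift hv hd'.1 n fun j hj => ?_
      have h := (hd'.2 (j + 1)).1.pshift_left_of_right
      simpa using h
    rwa [← e] at key

/-- A prime power denominator can be moved along its shift class to be compatible with `b`. -/
theorem exists_denomReduces_prime_pow {u v b p : F[X]} (hv : v ≠ 0) (hb : shiftFree b)
    (hb' : stronglyPrime b u v) (hp : Prime p) (n : ℕ) (hd : shiftFree (p ^ n))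
    (hd' : stronglyPrime (p ^ n) u v) :
    ∃ e, shiftFree (b * e) ∧ stronglyPrime (b * e) u v ∧ denomReduces u v (p ^ n) e := by
  by_cases h : ∀ i : ℤ, i ≠ 0 → IsCoprime p (pshift F i b)
  · exact ⟨p ^ n, hb.mul hd fun i hi => (h i hi).pow_left, hb'.mul hd', denomReduces.refl _ _ _⟩
  · push Not at h
    obtain ⟨i, -, hi⟩ := h
    have hdvd : p ∣ pshift F i b := (hp.irreducible.isCoprime_or_dvd _).resolve_left hi
    have hdvd' : pshift F (-i) p ∣ b := by
      simpa [pshift_pshift, pshift_zero] using map_dvd (pshift F (-i)) hdvd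
    have hpow : pshift F (-i) (p ^ n) ∣ b ^ n := by
      rw [map_pow]
      exact pow_dvd_pow_of_dvd hdvd' n
    have hne : pshift F (-i) (p ^ n) ≠ 0 := pshift_ne_zero _ hd.1
    have hmul : b * pshift F (-i) (p ^ n) ∣ b ^ (n + 1) := by
      rw [pow_succ']
      exact mul_dvd_mul_left b hpow
    exact ⟨pshift F (-i) (p ^ n), hb.of_dvd_pow (mul_ne_zero hb.1 hne) hmul,
      hb'.of_dvd_pow (mul_ne_zero hb.1 hne) hmul,
      denomReduces_of_stronglyPrime hv _ hd' (hb'.of_dvd_pow hne hpow)⟩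

theorem exists_denomReduces {u v d : F[X]} (hv : v ≠ 0) (hd : shiftFree d)
    (hd' : stronglyPrime d u v) : ∀ b : F[X], shiftFree b → stronglyPrime b u v →
    ∃ e, shiftFree (b * e) ∧ stronglyPrime (b * e) u v ∧ denomReduces u v d e := by
  induction d using UniqueFactorizationMonoid.induction_on_coprime with
  | h0 => exact absurd rfl hd.1
  | @h1 x hx =>
    intro b hb hb'
    refine ⟨x, hb.mul hd fun i _ => ?_, hb'.mul hd', denomReduces.refl _ _ _⟩
    exact (isCoprime_one_left).of_isCoprime_of_dvd_left hx.dvd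
  | hpr n hp => exact fun b hb hb' => exists_denomReduces_prime_pow hv hb hb' hp n hd hd'
  | @hcp x y hxy ihx ihy =>
    intro b hb hb'
    have hx : x ≠ 0 := left_ne_zero_of_mul hd.1
    have hy : y ≠ 0 := right_ne_zero_of_mul hd.1
    have hxd : x ∣ (x * y) ^ 1 := by simp
    have hyd : y ∣ (x * y) ^ 1 := by simp
    obtain ⟨e₁, h₁, h₁', hr₁⟩ := ihx (hd.of_dvd_pow hx hxd) (hd'.of_dvd_pow hx hxd) b hb hb'
    obtain ⟨e₂, h₂, h₂', hr₂⟩ := ihy (hd.of_dvd_pow hy hyd) (hd'.of_dvd_pow hy hyd) _ h₁ h₁'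
    rw [mul_assoc] at h₂ h₂'
    have he := right_ne_zero_of_mul h₂.1
    exact ⟨e₁ * e₂, h₂, h₂', hr₁.mul hx hy (left_ne_zero_of_mul he) (right_ne_zero_of_mul he)
      hxy.isCoprime hr₂⟩

theorem exists_sub_phiK_mem_WK (u v f : F[X]) : ∃ p, f - phiK u v p ∈ WK F u v := by
  have hphi : ∀ p q, phiK u v (p + q) = phiK u v p + phiK u v q := fun p q => by
    simp only [phiK, map_add]
    ring
  induction hn : f.degree using WellFoundedLT.induction generalizing f with
  | ind n ih =>
    subst hn
    by_cases hf : f = 0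
    · exact ⟨0, by simp [hf, phiK]⟩
    by_cases h : ∃ w, phiK u v w ≠ 0 ∧ f.natDegree = (phiK u v w).natDegree
    · obtain ⟨w, hw, hdeg⟩ := h
      set c := f.leadingCoeff / (phiK u v w).leadingCoeff with hc
      have hlc := leadingCoeff_ne_zero.2 hw
      have hc0 : c ≠ 0 := div_ne_zero (leadingCoeff_ne_zero.2 hf) hlc
      have hsm : phiK u v (C c * w) = C c * phiK u v w := by
        simp only [phiK, map_mul]
        simp only [pshift, aeval_C, algebraMap_eq]
        ring
      have hlt : (f - phiK u v (C c * w)).degree < f.degree := by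
        rw [hsm]
        refine degree_sub_lt_left ?_ hf ?_
        · rw [degree_C_mul hc0, degree_eq_natDegree hf, degree_eq_natDegree hw, hdeg]
        · rw [leadingCoeff_mul, leadingCoeff_C, hc, div_mul_cancel₀ _ hlc]
      obtain ⟨p, hp⟩ := ih _ hlt _ rfl
      exact ⟨C c * w + p, by rwa [hphi, ← sub_sub]⟩
    · push Not at h
      have hlt : (f - C f.leadingCoeff * X ^ f.natDegree).degree < f.degree := by
        rw [self_sub_C_mul_X_pow]
        exact degree_eraseLead_lt hf
      obtain ⟨p, hp⟩ := ih _ hlt _ rfl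
      refine ⟨p, ?_⟩
      have hX : (X ^ f.natDegree : F[X]) ∈ WK F u v := by
        refine Submodule.subset_span ⟨_, rfl, ?_⟩
        rintro _ ⟨w, rfl⟩ hw
        exact h w hw
      have := (WK F u v).add_mem hp ((WK F u v).smul_mem f.leadingCoeff hX)
      rw [smul_eq_C_mul] at this
      convert this using 1
      ring

theorem div_sub_mem_VK_of_phiK {u v : F[X]} (hv : v ≠ 0) (p : F[X]) :
    ι (phiK u v p) / ι v ∈ VK (ι u / ι v) := by
  refine ⟨ι p, ?_⟩
  have hv' := ratFunc_algebraMap_ne_zero hv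
  rw [rshift_eq_ratShift, ratShift_algebraMap, phiK, map_sub, map_mul, map_mul]
  field_simp

/-- A fraction `a / b + q / v` is congruent modulo `V_K` to one with `a / b` proper and
`q ∈ W_K`. -/
theorem exists_proper_sub_mem_VK {u v b : F[X]} (hv : v ≠ 0) (hb : b ≠ 0) (a q : F[X]) :
    ∃ a' q' : F[X], a'.degree < b.degree ∧ q' ∈ WK F u v ∧
      (ι a / ι b + ι q / ι v) - (ι a' / ι b + ι q' / ι v) ∈ VK (ι u / ι v) := by
  obtain ⟨p, hp⟩ := exists_sub_phiK_mem_WK u v (q + v * (a / b))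
  refine ⟨a % b, _, EuclideanDomain.mod_lt a hb, hp, ?_⟩
  convert div_sub_mem_VK_of_phiK hv p using 1
  have hv' := ratFunc_algebraMap_ne_zero hv
  have hb' := ratFunc_algebraMap_ne_zero hb
  have ha : ι a = ι b * ι (a / b) + ι (a % b) := by
    rw [← map_mul, ← map_add, EuclideanDomain.div_add_mod]
  rw [ha]
  simp only [map_sub, map_add, map_mul]
  field_simp
  ring

theorem degree_smul_mul_add_lt {a b a' b' : F[X]} (h : a.degree < b.degree)
    (h' : a'.degree < b'.degree) (l m : F) :
    (C l * (a * b') + C m * (a' * b)).degree < (b * b').degree := by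
  have hb : b ≠ 0 := ne_zero_of_degree_gt h
  have hb' : b' ≠ 0 := ne_zero_of_degree_gt h'
  have key : ∀ {x y z : F[X]} (c : F), x.degree < y.degree → z ≠ 0 →
      (C c * (x * z)).degree < (y * z).degree := fun {x y z} c hxy hz => by
    have hle : (C c * (x * z)).degree ≤ (x * z).degree := by
      rw [← smul_eq_C_mul]
      exact degree_smul_le _ _
    refine hle.trans_lt ?_
    rw [degree_mul, degree_mul]
    exact WithBot.add_lt_add_right (degree_ne_bot.2 hz) hxy
  refine (degree_add_le _ _).trans_lt (max_lt (key l h hb') ?_)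
  rw [mul_comm b]
  exact key m h' hb

end Reduction

/-- Given residual forms r, s w.r.t. K there is a residual form t with
s ≡ t mod V_K such that λ·r + μ·t is a residual form for all λ, μ ∈ F, congruent to
λ·r + μ·s modulo V_K. -/
theorem stmt19 {F : Type*} [Field F] [CharZero F] (u v : Polynomial F) (r s : RatFunc F)
    (hsr : shiftReducedPair u v) (hK1 : RatFunc.mk u v ≠ 1)
    (hr : residualForm u v r) (hs : residualForm u v s) :
    ∃ t : RatFunc F, residualForm u v t ∧ s - t ∈ VK (RatFunc.mk u v) ∧
      ∀ lam mu : F, residualForm u v (lam • r + mu • t) ∧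
        (lam • r + mu • s) - (lam • r + mu • t) ∈ VK (RatFunc.mk u v) := by
  obtain ⟨a, b, q, hab, hb, hb', hq, rfl⟩ := hr
  obtain ⟨a₁, d, q₁, -, hd, hd', -, rfl⟩ := hs
  have hv := hsr.2.1
  simp only [RatFunc.mk_eq_div]
  obtain ⟨e, he, he', hred⟩ := exists_denomReduces hv hd hd' b hb hb'
  have he0 : e ≠ 0 := right_ne_zero_of_mul he.1
  obtain ⟨a₂, q₂, h₂⟩ := hred a₁
  obtain ⟨a₃, q₃, ha₃, hq₃, h₃⟩ := exists_proper_sub_mem_VK (u := u) hv he0 a₂ (q₁ + q₂)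
  have hed : e ∣ (b * e) ^ 1 := by simp
  have hst := VK_add h₂ h₃
  refine ⟨algebraMap _ _ a₃ / algebraMap _ _ e + algebraMap _ _ q₃ / algebraMap _ _ v,
    ⟨a₃, e, q₃, ha₃, he.of_dvd_pow he0 hed, he'.of_dvd_pow he0 hed, hq₃, ?_⟩, ?_, ?_⟩
  · simp only [RatFunc.mk_eq_div]
  · convert hst using 1
    rw [map_add]
    ring
  · intro l m
    refine ⟨⟨C l * (a * e) + C m * (a₃ * b), b * e, C l * q + C m * q₃,
      degree_smul_mul_add_lt hab ha₃ l m, he, he', ?_, ?_⟩, ?_⟩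
    · rw [← smul_eq_C_mul, ← smul_eq_C_mul]
      exact add_mem (Submodule.smul_mem _ _ hq) (Submodule.smul_mem _ _ hq₃)
    · have hC : ∀ c : F, algebraMap F (RatFunc F) c = algebraMap F[X] (RatFunc F) (C c) :=
        fun _ => rfl
      have hv' := ratFunc_algebraMap_ne_zero hv
      have hb0 := ratFunc_algebraMap_ne_zero hb.1
      have he0' := ratFunc_algebraMap_ne_zero he0
      simp only [RatFunc.mk_eq_div, Algebra.smul_def, hC, map_add, map_mul]
      field_simp
      ring
    · convert VK_smul m hst using 1
      rw [add_sub_add_left_eq_sub, ← smul_sub, map_add]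
      congr 1
      ring
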